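/- Let Ω^j be a sequence of domains in ℂⁿ converging to a domain Ω_∞ ⊂ ℂⁿ in the local Hausdorff sense, such that K_{Ω_∞}(z,z) ≠ 0 for all z ∈ Ω_∞ and K_{Ω^j}(z,z) → K_{Ω_∞}(z,z) for every z ∈ Ω_∞. Then K_{Ω^j}(z,w) → K_{Ω_∞}(z,w) uniformly on compact subsets of Ω_∞ × Ω_∞, together with all partial derivatives. -/

import Mathlib

open MeasureTheory Metric Filter Topology Set
open scoped ENNReal

noncomputable section

/-- Membership in the Bergman space `A²(Ω)`: holomorphic and square-integrable. -/
def MemA2 {n : ℕ} (Ω : Set (Fin n → ℂ)) (f : (Fin n → ℂ) → ℂ) : Prop :=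
  DifferentiableOn ℂ f Ω ∧ MemLp f 2 (volume.restrict Ω)

/-- `K` is the Bergman kernel of `Ω`: the reproducing kernel of `A²(Ω)`. -/
def IsBergmanKernel {n : ℕ} (Ω : Set (Fin n → ℂ)) (K : (Fin n → ℂ) → (Fin n → ℂ) → ℂ) : Prop :=
  (∀ w ∈ Ω, MemA2 Ω fun z => K z w) ∧
  ∀ f, MemA2 Ω f → ∀ w ∈ Ω, f w = ∫ z in Ω, f z * (starRingEnd ℂ) (K z w)

/-- Wirtinger derivative `∂f/∂z_μ`. -/
def wderiv {n : ℕ} (μ : Fin n) (f : (Fin n → ℂ) → ℂ) (z : Fin n → ℂ) : ℂ :=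
  (fderiv ℝ f z (Pi.single μ 1) - Complex.I * fderiv ℝ f z (Pi.single μ Complex.I)) / 2

/-- Wirtinger derivative `∂f/∂z̄_μ`. -/
def wderivBar {n : ℕ} (μ : Fin n) (f : (Fin n → ℂ) → ℂ) (z : Fin n → ℂ) : ℂ :=
  (fderiv ℝ f z (Pi.single μ 1) + Complex.I * fderiv ℝ f z (Pi.single μ Complex.I)) / 2

/-- One-variable Wirtinger derivative `∂f/∂z`. -/
def wderiv1 (f : ℂ → ℂ) (z : ℂ) : ℂ :=
  (fderiv ℝ f z 1 - Complex.I * fderiv ℝ f z Complex.I) / 2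

/-- One-variable Wirtinger derivative `∂f/∂z̄`. -/
def wderiv1Bar (f : ℂ → ℂ) (z : ℂ) : ℂ :=
  (fderiv ℝ f z 1 + Complex.I * fderiv ℝ f z Complex.I) / 2

/-- Bergman metric tensor `g_{μν}(z) = ∂² log K(z,z) / ∂z_μ ∂z̄_ν`. -/
def bergmanTensor {n : ℕ} (K : (Fin n → ℂ) → (Fin n → ℂ) → ℂ) (μ ν : Fin n)
    (z : Fin n → ℂ) : ℂ :=
  wderiv μ (fun w => wderivBar ν (fun u => Complex.log (K u u)) w) z

/-- The hermitian quadratic form of the Bergman metric. -/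
def bergmanQuad {n : ℕ} (K : (Fin n → ℂ) → (Fin n → ℂ) → ℂ) (z ξ : Fin n → ℂ) : ℝ :=
  (∑ μ, ∑ ν, bergmanTensor K μ ν z * ξ μ * (starRingEnd ℂ) (ξ ν)).re

/-- The Bergman metric `b_Ω(z,ξ)`. -/
def bergmanMetric {n : ℕ} (K : (Fin n → ℂ) → (Fin n → ℂ) → ℂ) (z ξ : Fin n → ℂ) : ℝ :=
  Real.sqrt (bergmanQuad K z ξ)

/-- Piecewise-`C¹` curves on `[0,1]`. -/
def PiecewiseC1 {n : ℕ} (γ : ℝ → (Fin n → ℂ)) : Prop :=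
  ContinuousOn γ (Set.Icc 0 1) ∧
  ∃ (k : ℕ) (t : Fin (k + 1) → ℝ), StrictMono t ∧ t 0 = 0 ∧ t (Fin.last k) = 1 ∧
    ∀ i : Fin k, ContDiffOn ℝ 1 γ (Set.Icc (t i.castSucc) (t i.succ))

/-- The Bergman length of a curve. -/
def bergmanLength {n : ℕ} (K : (Fin n → ℂ) → (Fin n → ℂ) → ℂ) (γ : ℝ → (Fin n → ℂ)) : ℝ :=
  ∫ t in (0:ℝ)..1, bergmanMetric K (γ t) (deriv γ t)

/-- The Bergman pseudodistance of `Ω`. -/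
def bergmanDist {n : ℕ} (Ω : Set (Fin n → ℂ)) (K : (Fin n → ℂ) → (Fin n → ℂ) → ℂ)
    (z w : Fin n → ℂ) : ℝ :=
  sInf { L : ℝ | ∃ γ : ℝ → (Fin n → ℂ), γ 0 = z ∧ γ 1 = w ∧
    (∀ t ∈ Set.Icc (0:ℝ) 1, γ t ∈ Ω) ∧ PiecewiseC1 γ ∧ L = bergmanLength K γ }

/-- The Bergman ball `B_Ω(p,r)`. -/
def bergmanBall {n : ℕ} (Ω : Set (Fin n → ℂ)) (K : (Fin n → ℂ) → (Fin n → ℂ) → ℂ)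
    (p : Fin n → ℂ) (r : ℝ) : Set (Fin n → ℂ) :=
  { z ∈ Ω | bergmanDist Ω K p z < r }

/-- The Bergman pseudodistance is an honest distance. -/
def BergmanDistIsDistance {n : ℕ} (Ω : Set (Fin n → ℂ))
    (K : (Fin n → ℂ) → (Fin n → ℂ) → ℂ) : Prop :=
  ∀ z ∈ Ω, ∀ w ∈ Ω, z ≠ w → 0 < bergmanDist Ω K z w

/-- `Ω` is complete with respect to the Bergman distance. -/
def BergmanComplete {n : ℕ} (Ω : Set (Fin n → ℂ))
    (K : (Fin n → ℂ) → (Fin n → ℂ) → ℂ) : Prop :=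
  ∀ x : ℕ → (Fin n → ℂ), (∀ k, x k ∈ Ω) →
    (∀ ε : ℝ, 0 < ε → ∃ N, ∀ k ≥ N, ∀ l ≥ N, bergmanDist Ω K (x k) (x l) < ε) →
    ∃ p ∈ Ω, Filter.Tendsto (fun k => bergmanDist Ω K (x k) p) Filter.atTop (nhds 0)

/-- The Euclidean unit ball `𝔹ⁿ ⊂ ℂⁿ`. -/
def euclUnitBall (n : ℕ) : Set (Fin n → ℂ) :=
  { z | ∑ μ, ‖z μ‖ ^ 2 < 1 }

/-- The Bergman–Fridman invariant `h_X(p)`. -/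
def fridmanInv {n : ℕ} (Ω : Set (Fin n → ℂ)) (K : (Fin n → ℂ) → (Fin n → ℂ) → ℂ)
    (p : Fin n → ℂ) : ℝ :=
  sInf { c : ℝ | ∃ r : ℝ, 0 < r ∧ c = 1 / r ∧ ∃ f : (Fin n → ℂ) → (Fin n → ℂ),
    DifferentiableOn ℂ f (euclUnitBall n) ∧ Set.InjOn f (euclUnitBall n) ∧
    f '' euclUnitBall n ⊆ Ω ∧ bergmanBall Ω K p r ⊆ f '' euclUnitBall n }

/-- Biholomorphic equivalence of domains in `ℂⁿ` (an injective holomorphic map of `ℂⁿ`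
restricted to a domain is automatically a biholomorphism onto its image). -/
def Biholomorphic {n : ℕ} (U V : Set (Fin n → ℂ)) : Prop :=
  ∃ f : (Fin n → ℂ) → (Fin n → ℂ),
    DifferentiableOn ℂ f U ∧ Set.InjOn f U ∧ f '' U = V

/-- The Levi form of a real-valued function `ρ` at `p` in direction `ξ`. -/
def leviForm {n : ℕ} (ρ : (Fin n → ℂ) → ℝ) (p ξ : Fin n → ℂ) : ℝ :=
  (∑ μ, ∑ ν, wderiv μ (fun w => wderivBar ν (fun u => (ρ u : ℂ)) w) p
      * ξ μ * (starRingEnd ℂ) (ξ ν)).re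

/-- The complex tangent space of `{ρ = 0}` at `p`. -/
def complexTangent {n : ℕ} (ρ : (Fin n → ℂ) → ℝ) (p : Fin n → ℂ) : Set (Fin n → ℂ) :=
  { ξ | ∑ μ, wderiv μ (fun u => (ρ u : ℂ)) p * ξ μ = 0 }

/-- Strong pseudoconvexity at a boundary point, for defining function `ρ`. -/
def StronglyPseudoconvexAt {n : ℕ} (ρ : (Fin n → ℂ) → ℝ) (p : Fin n → ℂ) : Prop :=
  ∀ ξ ∈ complexTangent ρ p, ξ ≠ 0 → 0 < leviForm ρ p ξ

/-- `ρ` is a (global) defining function for `D`. -/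
def IsDefiningFunction {n : ℕ} (D : Set (Fin n → ℂ)) (ρ : (Fin n → ℂ) → ℝ) : Prop :=
  (∀ z, z ∈ D ↔ ρ z < 0) ∧ ∀ z ∈ frontier D, fderiv ℝ ρ z ≠ 0

/-- Plurisubharmonicity via the sub-mean-value property on complex lines. -/
def PlurisubharmonicOn {n : ℕ} (u : (Fin n → ℂ) → ℝ) (Ω : Set (Fin n → ℂ)) : Prop :=
  UpperSemicontinuousOn u Ω ∧
  ∀ (a b : Fin n → ℂ) (r : ℝ), 0 < r →
    (∀ w : ℂ, ‖w‖ ≤ r → a + w • b ∈ Ω) →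
    u a ≤ (1 / (2 * Real.pi)) *
      ∫ θ in (0:ℝ)..(2 * Real.pi), u (a + ((r : ℂ) * Complex.exp (θ * Complex.I)) • b)

/-- Pseudoconvexity: `-log dist(·, ∂D)` is plurisubharmonic on `D`. -/
def IsPseudoconvex {n : ℕ} (D : Set (Fin n → ℂ)) : Prop :=
  PlurisubharmonicOn (fun z => -Real.log (Metric.infDist z Dᶜ)) D

/-- Order of vanishing at `0` of a vector-valued map on `ℂ` (`⊤` if it vanishes to
infinite order). -/
def vanishingOrderC {n : ℕ} (f : ℂ → (Fin n → ℂ)) : ℝ≥0∞ :=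
  sInf ((fun m : ℕ => (m : ℝ≥0∞)) '' { m : ℕ | iteratedDeriv m f 0 ≠ 0 })

/-- Order of vanishing at `0` of a real-valued function on `ℂ`. -/
def vanishingOrderR (g : ℂ → ℝ) : ℝ≥0∞ :=
  sInf ((fun m : ℕ => (m : ℝ≥0∞)) '' { m : ℕ | iteratedFDeriv ℝ m g 0 ≠ 0 })

/-- The D'Angelo 1-type of `ρ` at `p`. -/
def dAngeloOneType {n : ℕ} (ρ : (Fin n → ℂ) → ℝ) (p : Fin n → ℂ) : ℝ≥0∞ :=
  ⨆ (φ : ℂ → (Fin n → ℂ)) (_ : AnalyticAt ℂ φ 0) (_ : φ 0 = p)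
    (_ : vanishingOrderC (fun w => φ w - p) ≠ ⊤),
    vanishingOrderR (fun w => ρ (φ w)) / vanishingOrderC (fun w => φ w - p)

/-- The Levi form at `p` has at most one degenerate eigenvalue. -/
def LeviCorankOneAt {n : ℕ} (ρ : (Fin n → ℂ) → ℝ) (p : Fin n → ℂ) : Prop :=
  ∃ V : Submodule ℂ (Fin n → ℂ), n - 2 ≤ Module.finrank ℂ V ∧
    (V : Set (Fin n → ℂ)) ⊆ complexTangent ρ p ∧
    ∀ ξ ∈ V, ξ ≠ 0 → 0 < leviForm ρ p ξ

/-- A bounded smooth pseudoconvex finite-type Levi corank one domain, with defining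
function `ρ`. -/
def IsLeviCorankOneDomain {n : ℕ} (D : Set (Fin n → ℂ)) (ρ : (Fin n → ℂ) → ℝ) : Prop :=
  IsOpen D ∧ IsConnected D ∧ Bornology.IsBounded D ∧ IsPseudoconvex D ∧
  ContDiff ℝ (⊤ : ℕ∞) ρ ∧ IsDefiningFunction D ρ ∧
  (∀ p ∈ frontier D, dAngeloOneType ρ p ≠ ⊤) ∧
  ∀ p ∈ frontier D, LeviCorankOneAt ρ p

/-- The open unit disc in `ℂ`. -/
def openUnitDisc : Set ℂ := Metric.ball 0 1

/-- Tautness of a domain in `ℂⁿ`. -/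
def IsTaut {n : ℕ} (D : Set (Fin n → ℂ)) : Prop :=
  ∀ f : ℕ → ℂ → (Fin n → ℂ),
    (∀ k, DifferentiableOn ℂ (f k) openUnitDisc ∧ f k '' openUnitDisc ⊆ D) →
    ∃ φ : ℕ → ℕ, StrictMono φ ∧
      ((∃ g : ℂ → (Fin n → ℂ), DifferentiableOn ℂ g openUnitDisc ∧ g '' openUnitDisc ⊆ D ∧
          TendstoLocallyUniformlyOn (fun k => f (φ k)) g Filter.atTop openUnitDisc) ∨
        ∀ S : Set ℂ, IsCompact S → S ⊆ openUnitDisc →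
          ∀ L : Set (Fin n → ℂ), IsCompact L → L ⊆ D →
            ∀ᶠ k in Filter.atTop, ∀ w ∈ S, f (φ k) w ∉ L)

/-- Convergence of a sequence of domains in the local Hausdorff sense. -/
def LocalHausdorffConv {n : ℕ} (Ω : ℕ → Set (Fin n → ℂ)) (Ωl : Set (Fin n → ℂ)) : Prop :=
  (∀ S : Set (Fin n → ℂ), IsCompact S → S ⊆ Ωl → ∀ᶠ j in Filter.atTop, S ⊆ Ω j) ∧
  ∀ S : Set (Fin n → ℂ), IsCompact S →
    (∃ j₀ : ℕ, S ⊆ interior (⋂ j, ⋂ (_ : j₀ ≤ j), Ω j)) → S ⊆ Ωl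

/-- A real-valued subharmonic polynomial of degree at most `d` in one complex variable,
containing no harmonic terms. -/
def SubharmonicPolyNoHarm (P : ℂ → ℝ) (d : ℕ) : Prop :=
  (∃ c : Fin (d + 1) → Fin (d + 1) → ℂ,
    (∀ j, c j 0 = 0) ∧ (∀ k, c 0 k = 0) ∧
    ∀ w : ℂ, (P w : ℂ) = ∑ j, ∑ k, c j k * w ^ (j : ℕ) * (starRingEnd ℂ) w ^ (k : ℕ)) ∧
  ∀ w : ℂ, 0 ≤ (wderiv1 (fun u => wderiv1Bar (fun v => (P v : ℂ)) u) w).re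

/-- A strictly subharmonic real polynomial of degree `2` in one complex variable. -/
def StrictlySubharmonicPolyDeg2 (Q : ℂ → ℝ) : Prop :=
  (∃ c : Fin 3 → Fin 3 → ℂ, ∀ w : ℂ,
      (Q w : ℂ) = ∑ j, ∑ k, c j k * w ^ (j : ℕ) * (starRingEnd ℂ) w ^ (k : ℕ)) ∧
  ∀ w : ℂ, 0 < (wderiv1 (fun u => wderiv1Bar (fun v => (Q v : ℂ)) u) w).re

/-- A nontangential cone in `D` with vertex `p0 ∈ ∂D`. -/
def IsNontangentialCone {n : ℕ} (D Γ : Set (Fin n → ℂ)) (p0 : Fin n → ℂ) : Prop :=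
  Γ ⊆ D ∧ p0 ∈ closure Γ ∧
  ∃ C : ℝ, 0 < C ∧ ∀ z ∈ Γ, ‖z - p0‖ ≤ C * Metric.infDist z Dᶜ

/-- The Bergman kernel is positive on the diagonal of `Ω`. -/
def DiagPos {n : ℕ} (Ω : Set (Fin n → ℂ)) (K : (Fin n → ℂ) → (Fin n → ℂ) → ℂ) : Prop :=
  ∀ z ∈ Ω, (K z z).im = 0 ∧ 0 < (K z z).re

/-- The Bergman metric of `Ω` is positive definite. -/
def BergPosDef {n : ℕ} (Ω : Set (Fin n → ℂ)) (K : (Fin n → ℂ) → (Fin n → ℂ) → ℂ) : Prop :=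
  ∀ z ∈ Ω, ∀ ξ : Fin n → ℂ, ξ ≠ 0 → 0 < bergmanMetric K z ξ

/-- The real coordinate directions of `ℂⁿ ≃ ℝ^{2n}`. -/
def realDir {n : ℕ} (μ : Fin (2 * n)) : Fin n → ℂ :=
  Pi.single ⟨(μ : ℕ) / 2, by have := μ.isLt; omega⟩
    (if (μ : ℕ) % 2 = 0 then 1 else Complex.I)

/-- The real coefficients `g̃_{μν}` of the Bergman metric, obtained by polarization. -/
def realTensor {n : ℕ} (K : (Fin n → ℂ) → (Fin n → ℂ) → ℂ) (μ ν : Fin (2 * n))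
    (z : Fin n → ℂ) : ℝ :=
  (bergmanQuad K z (realDir μ + realDir ν) - bergmanQuad K z (realDir μ)
    - bergmanQuad K z (realDir ν)) / 2

/-- The Christoffel symbols `Γ^η_{μν}` of the Bergman metric, in real coordinates. -/
def christoffel {n : ℕ} (K : (Fin n → ℂ) → (Fin n → ℂ) → ℂ) (η μ ν : Fin (2 * n))
    (z : Fin n → ℂ) : ℝ :=
  (1 / 2) * ∑ τ : Fin (2 * n),
    (fderiv ℝ (realTensor K ν τ) z (realDir μ)
      + fderiv ℝ (realTensor K τ μ) z (realDir ν)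
      - fderiv ℝ (realTensor K μ ν) z (realDir τ))
    * (Matrix.of fun a b => realTensor K a b z)⁻¹ τ η

/-- `z0 ∈ ∂D` is a local holomorphic peak point of `D`. -/
def IsLocalPeakPoint {n : ℕ} (D : Set (Fin n → ℂ)) (z0 : Fin n → ℂ) : Prop :=
  ∃ U ∈ nhds z0, ∃ g : (Fin n → ℂ) → ℂ,
    DifferentiableOn ℂ g (U ∩ D) ∧ ContinuousOn g (closure (U ∩ D)) ∧
    g z0 = 1 ∧ ∀ z ∈ closure (U ∩ D), z ≠ z0 → ‖g z‖ < 1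

/-- A real polynomial on `ℂⁿ` containing no pluriharmonic terms. -/
def IsPolyNoPluriharm {n : ℕ} (P : (Fin n → ℂ) → ℝ) : Prop :=
  ∃ (d : ℕ) (c : (Fin n → Fin (d + 1)) → (Fin n → Fin (d + 1)) → ℂ),
    (∀ α β, (∀ j, (β j : ℕ) = 0) → c α β = 0) ∧
    (∀ α β, (∀ j, (α j : ℕ) = 0) → c α β = 0) ∧
    ∀ z, (P z : ℂ) = ∑ α, ∑ β, c α β * (∏ j, z j ^ (α j : ℕ)) *
      ∏ j, (starRingEnd ℂ) (z j) ^ (β j : ℕ)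

theorem norm_fderiv_le_of_norm_le_ball {E G : Type*} [NormedAddCommGroup E] [NormedSpace ℂ E]
    [NormedAddCommGroup G] [NormedSpace ℂ G] {f : E → G} {c : E} {R M : ℝ} (hR : 0 < R)
    (hd : DifferentiableOn ℂ f (ball c R)) (hM : ∀ x ∈ ball c R, ‖f x‖ ≤ M) :
    ‖fderiv ℂ f c‖ ≤ 2 * M / R := by
  refine Complex.norm_fderiv_le_div_of_mapsTo_ball hd (fun x hx => ?_) hR
  rw [mem_closedBall, dist_eq_norm]
  linarith [norm_sub_le (f x) (f c), hM x hx, hM c (mem_ball_self hR)]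

theorem dist_le_of_norm_le_ball {E G : Type*} [NormedAddCommGroup E] [NormedSpace ℂ E]
    [NormedAddCommGroup G] [NormedSpace ℂ G] {f : E → G} {c : E} {R M : ℝ} (hR : 0 < R)
    (hd : DifferentiableOn ℂ f (ball c R)) (hM : ∀ x ∈ ball c R, ‖f x‖ ≤ M)
    {x y : E} (hx : x ∈ ball c (R / 4)) (hy : y ∈ ball c (R / 4)) :
    dist (f x) (f y) ≤ 4 * M / R * dist x y := by
  have hsub : ball y (R / 2) ⊆ ball c R := by
    refine ball_subset_ball' ?_
    rw [mem_ball] at hy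
    linarith
  have hxy : x ∈ ball y (R / 2) := by
    rw [mem_ball] at *
    linarith [dist_triangle_right x y c]
  have := Complex.dist_le_div_mul_dist_of_mapsTo_ball (R₂ := 2 * M) (hd.mono hsub) (fun u hu => by
    rw [mem_closedBall, dist_eq_norm]
    linarith [norm_sub_le (f u) (f y), hM u (hsub hu), hM y (hsub (mem_ball_self (by linarith)))])
    hxy
  convert this using 2
  field_simp
  ring

/-- A partial derivative of a function which is holomorphic in the first variable and Lipschitz is
continuous. -/
theorem continuousAt_fderiv_fst {E F G : Type*} [NormedAddCommGroup E] [NormedSpace ℂ E]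
    [NormedAddCommGroup F] [NormedAddCommGroup G] [NormedSpace ℂ G]
    {f : E → F → G} {a : E} {b : F} {R L : ℝ} (hR : 0 < R)
    (hd : ∀ y ∈ ball b R, DifferentiableOn ℂ (fun x => f x y) (ball a R))
    (hL : ∀ x ∈ ball a R, ∀ x' ∈ ball a R, ∀ y ∈ ball b R, ∀ y' ∈ ball b R,
      dist (f x y) (f x' y') ≤ L * (dist x x' + dist y y')) :
    ContinuousAt (fun q : E × F => fderiv ℂ (fun x => f x q.2) q.1) (a, b) := by
  rw [ContinuousAt, tendsto_iff_dist_tendsto_zero]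
  have key : ∀ᶠ q : E × F in 𝓝 (a, b), dist (fderiv ℂ (fun x => f x q.2) q.1)
      (fderiv ℂ (fun x => f x b) a) ≤ 2 * (L * (dist q.1 a + dist q.2 b)) / (R / 2) := by
    filter_upwards [ball_mem_nhds (a, b) (half_pos hR)] with q hq
    rw [← ball_prod_same] at hq
    obtain ⟨h1, h2⟩ := hq
    have h2' : q.2 ∈ ball b R := ball_subset_ball (by linarith) h2
    have hb : b ∈ ball b R := mem_ball_self hR
    have hsh : ∀ x ∈ ball a (R / 2), x + (q.1 - a) ∈ ball a R := fun x hx => by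
      rw [mem_ball, dist_eq_norm] at *
      calc ‖x + (q.1 - a) - a‖ = ‖(x - a) + (q.1 - a)‖ := by congr 1; abel
        _ ≤ ‖x - a‖ + ‖q.1 - a‖ := norm_add_le _ _
        _ < R := by linarith
    have hin : ∀ x ∈ ball a (R / 2), x ∈ ball a R :=
      fun x hx => ball_subset_ball (by linarith) hx
    have e1 : fderiv ℂ (fun x => f x q.2) q.1 = fderiv ℂ (fun x => f (x + (q.1 - a)) q.2) a := by
      rw [fderiv_comp_add_right (f := fun x => f x q.2)]
      simp
    have d1 : DifferentiableOn ℂ (fun x => f (x + (q.1 - a)) q.2) (ball a (R / 2)) :=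
      (hd q.2 h2').comp (differentiableOn_id.add_const _) hsh
    have d2 : DifferentiableOn ℂ (fun x => f x b) (ball a (R / 2)) :=
      (hd b hb).mono hin
    have ha : ball a (R / 2) ∈ 𝓝 a := ball_mem_nhds _ (half_pos hR)
    rw [e1, dist_eq_norm, ← fderiv_fun_sub (d1.differentiableAt ha) (d2.differentiableAt ha)]
    refine norm_fderiv_le_of_norm_le_ball (half_pos hR) (d1.sub d2) fun x hx => ?_
    rw [← dist_eq_norm]
    refine (hL _ (hsh x hx) _ (hin x hx) _ h2' _ hb).trans_eq ?_
    rw [dist_eq_norm, dist_eq_norm q.1]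
    simp
  refine squeeze_zero' (Eventually.of_forall fun _ => dist_nonneg) key ?_
  have : Continuous fun q : E × F => 2 * (L * (dist q.1 a + dist q.2 b)) / (R / 2) := by fun_prop
  simpa using this.tendsto (a, b)

/-- **Osgood's lemma**: a locally bounded separately holomorphic function is holomorphic. -/
theorem differentiableAt_of_separately {E F G : Type*} [NormedAddCommGroup E] [NormedSpace ℂ E]
    [NormedAddCommGroup F] [NormedSpace ℂ F] [NormedAddCommGroup G] [NormedSpace ℂ G]
    {f : E → F → G} {a : E} {b : F} {R M : ℝ} (hR : 0 < R)
    (hd₁ : ∀ y ∈ ball b R, DifferentiableOn ℂ (fun x => f x y) (ball a R))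
    (hd₂ : ∀ x ∈ ball a R, DifferentiableOn ℂ (fun y => f x y) (ball b R))
    (hM : ∀ x ∈ ball a R, ∀ y ∈ ball b R, ‖f x y‖ ≤ M) :
    DifferentiableAt ℂ (fun q : E × F => f q.1 q.2) (a, b) := by
  have hr : 0 < R / 4 := by linarith
  have hsub : R / 4 ≤ R := by linarith
  have hL : ∀ x ∈ ball a (R / 4), ∀ x' ∈ ball a (R / 4), ∀ y ∈ ball b (R / 4),
      ∀ y' ∈ ball b (R / 4),
      dist (f x y) (f x' y') ≤ 4 * M / R * (dist x x' + dist y y') := by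
    intro x hx x' hx' y hy y' hy'
    have h1 := dist_le_of_norm_le_ball hR (hd₁ y (ball_subset_ball hsub hy))
      (fun u hu => hM u hu y (ball_subset_ball hsub hy)) hx hx'
    have h2 := dist_le_of_norm_le_ball hR (hd₂ x' (ball_subset_ball hsub hx'))
      (fun u hu => hM x' (ball_subset_ball hsub hx') u hu) hy hy'
    rw [mul_add]
    exact (dist_triangle _ (f x' y) _).trans (add_le_add h1 h2)
  have c1 := continuousAt_fderiv_fst hr
    (fun y hy => (hd₁ y (ball_subset_ball hsub hy)).mono (ball_subset_ball hsub)) hL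
  have c2 := continuousAt_fderiv_fst (f := fun y x => f x y) hr
    (fun x hx => (hd₂ x (ball_subset_ball hsub hx)).mono (ball_subset_ball hsub))
    (fun y hy y' hy' x hx x' hx' => by rw [add_comm]; exact hL x hx x' hx' y hy y' hy')
  have c2' : ContinuousAt (fun q : E × F => fderiv ℂ (fun y => f q.1 y) q.2) (a, b) :=
    ContinuousAt.comp (x := (a, b)) (f := Prod.swap) c2 continuous_swap.continuousAt
  have hball : ∀ᶠ v : E × F in 𝓝 (a, b), v.1 ∈ ball a R ∧ v.2 ∈ ball b R := by
    filter_upwards [ball_mem_nhds (a, b) hR] with q hq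
    rwa [← ball_prod_same] at hq
  have := hasStrictFDerivAt_uncurry_coprod (u := (a, b)) (f := f)
    (f₁ := fun x y => fderiv ℂ (fun x => f x y) x) (f₂ := fun x y => fderiv ℂ (fun y => f x y) y)
    (hball.mono fun v hv =>
      ((hd₁ v.2 hv.2).differentiableAt (isOpen_ball.mem_nhds hv.1)).hasFDerivAt)
    (hball.mono fun v hv =>
      ((hd₂ v.1 hv.1).differentiableAt (isOpen_ball.mem_nhds hv.2)).hasFDerivAt) c1 c2'
  exact this.hasFDerivAt.differentiableAt

theorem differentiableOn_fderiv_apply {E : Type*} [NormedAddCommGroup E] [NormedSpace ℂ E]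
    [FiniteDimensional ℂ E] {f : E → ℂ} {U : Set E} (hU : IsOpen U) (hf : DifferentiableOn ℂ f U)
    (v : E) : DifferentiableOn ℂ (fun x => fderiv ℂ f x v) U := by
  intro x₀ hx₀
  apply DifferentiableAt.differentiableWithinAt
  have : ProperSpace E := FiniteDimensional.proper ℂ E
  obtain ⟨ε, hε, hεU⟩ := Metric.isOpen_iff.1 hU x₀ hx₀
  obtain ⟨ρ, hρ, hρε⟩ : ∃ ρ, 0 < ρ ∧ 3 * ρ < ε := ⟨ε / 4, by linarith, by linarith⟩
  have hcb : closedBall x₀ (3 * ρ) ⊆ U := (closedBall_subset_ball hρε).trans hεU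
  obtain ⟨M, hM⟩ := (isCompact_closedBall x₀ (3 * ρ)).exists_bound_of_continuousOn
    (hf.continuousOn.mono hcb)
  obtain ⟨r, hr, hrv⟩ : ∃ r : ℝ, 0 < r ∧ r * ‖v‖ ≤ ρ := by
    refine ⟨ρ / (‖v‖ + 1), by positivity, ?_⟩
    rw [div_mul_eq_mul_div, div_le_iff₀ (by positivity)]
    nlinarith [norm_nonneg v]
  have hshift : ∀ x ∈ ball x₀ ρ, ∀ ζ ∈ closedBall (0 : ℂ) r, x + ζ • v ∈ ball x₀ (2 * ρ) := by
    intro x hx ζ hζ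
    rw [mem_ball, dist_eq_norm] at *
    rw [mem_closedBall, dist_zero_right] at hζ
    calc ‖x + ζ • v - x₀‖ = ‖(x - x₀) + ζ • v‖ := by congr 1; abel
      _ ≤ ‖x - x₀‖ + ‖ζ‖ * ‖v‖ := (norm_add_le _ _).trans (by rw [norm_smul])
      _ ≤ ‖x - x₀‖ + r * ‖v‖ := by gcongr
      _ < 2 * ρ := by linarith
  have hinU : ball x₀ (2 * ρ) ⊆ U :=
    (ball_subset_closedBall.trans (closedBall_subset_closedBall (by linarith))).trans hcb
  have hbound : ∀ y ∈ ball x₀ (2 * ρ), ‖fderiv ℂ f y‖ ≤ 2 * M / ρ := by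
    intro y hy
    have hsub : ball y ρ ⊆ closedBall x₀ (3 * ρ) := by
      refine (ball_subset_ball' ?_).trans ball_subset_closedBall
      rw [mem_ball] at hy
      linarith
    exact norm_fderiv_le_of_norm_le_ball hρ (hf.mono (hsub.trans hcb)) fun z hz => hM z (hsub hz)
  have hγ : ∀ θ, circleMap 0 r θ ∈ closedBall (0 : ℂ) r := fun θ =>
    circleMap_mem_closedBall 0 hr.le θ
  set c : ℝ → ℂ := fun θ => deriv (circleMap 0 r) θ * ((circleMap 0 r θ - 0) ^ 2)⁻¹ with hc
  have hne : ∀ θ, (circleMap 0 r θ - 0) ^ 2 ≠ 0 := fun θ => by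
    have := circleMap_ne_center (c := 0) hr.ne' (θ := θ)
    simpa using this
  have hccont : Continuous c := by
    simp only [hc, deriv_circleMap]
    refine Continuous.mul (by fun_prop) (Continuous.inv₀ (by fun_prop) hne)
  have hrep : ∀ x ∈ ball x₀ ρ, fderiv ℂ f x v = (2 * Real.pi * Complex.I : ℂ)⁻¹ •
      ∫ θ in Ioc 0 (2 * Real.pi), c θ * f (x + circleMap 0 r θ • v) := by
    intro x hx
    have hxU : x ∈ U := hinU (ball_subset_ball (by linarith) hx)
    have hopen : IsOpen ((fun ζ : ℂ => x + ζ • v) ⁻¹' U) :=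
      hU.preimage (by fun_prop)
    have h1 := Complex.two_pi_I_inv_smul_circleIntegral_sub_sq_inv_smul_of_differentiable
      (f := fun ζ : ℂ => f (x + ζ • v)) (c := 0) (w₀ := 0) (R := r) hopen
      (fun ζ hζ => hinU (hshift x hx ζ hζ))
      (hf.comp (by fun_prop) fun ζ hζ => hζ) (mem_ball_self hr)
    have h2 : deriv (fun ζ : ℂ => f (x + ζ • v)) 0 = fderiv ℂ f x v := by
      have hg : HasDerivAt (fun ζ : ℂ => x + ζ • v) v 0 := by
        simpa using ((hasDerivAt_id (0 : ℂ)).smul_const v).const_add x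
      have hfx : HasFDerivAt f (fderiv ℂ f x) (x + (0 : ℂ) • v) := by
        simpa using (hf.differentiableAt (hU.mem_nhds hxU)).hasFDerivAt
      exact (hfx.comp_hasDerivAt 0 hg).deriv
    rw [← h2, ← h1, circleIntegral, intervalIntegral.integral_of_le (by positivity)]
    simp only [hc, smul_eq_mul, mul_assoc]
  have hcont : ∀ x ∈ ball x₀ ρ, Continuous fun θ => c θ * f (x + circleMap 0 r θ • v) := by
    intro x hx
    refine hccont.mul ?_
    exact hf.continuousOn.comp_continuous (by fun_prop) fun θ => hinU (hshift x hx _ (hγ θ))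
  have hfin : IsFiniteMeasure (volume.restrict (Ioc 0 (2 * Real.pi))) := by
    infer_instance
  borelize E
  have hder : HasFDerivAt (fun x => ∫ θ in Ioc 0 (2 * Real.pi), c θ * f (x + circleMap 0 r θ • v))
      (∫ θ in Ioc 0 (2 * Real.pi), c θ • fderiv ℂ f (x₀ + circleMap 0 r θ • v)) x₀ := by
    refine hasFDerivAt_integral_of_dominated_of_fderiv_le (𝕜 := ℂ)
      (F' := fun x θ => c θ • fderiv ℂ f (x + circleMap 0 r θ • v))
      (bound := fun θ => ‖c θ‖ * (2 * M / ρ)) (ball_mem_nhds x₀ hρ) ?_ ?_ ?_ ?_ ?_ ?_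
    · filter_upwards [ball_mem_nhds x₀ hρ] with x hx
      exact (hcont x hx).aestronglyMeasurable
    · exact (hcont x₀ (mem_ball_self hρ)).integrableOn_Ioc
    · have hm : Measurable fun θ : ℝ => fderiv ℂ f (x₀ + circleMap 0 r θ • v) :=
        (measurable_fderiv ℂ f).comp (by fun_prop : Continuous fun θ : ℝ =>
          x₀ + circleMap 0 r θ • v).measurable
      exact hccont.aestronglyMeasurable.smul hm.aestronglyMeasurable
    · refine Eventually.of_forall fun θ x hx => ?_
      rw [norm_smul]
      exact mul_le_mul_of_nonneg_left (hbound _ (hshift x hx _ (hγ θ))) (norm_nonneg _)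
    · exact Continuous.integrableOn_Ioc (by fun_prop)
    · refine Eventually.of_forall fun θ x hx => ?_
      have h := (hf.differentiableAt (hU.mem_nhds (hinU (hshift x hx _ (hγ θ))))).hasFDerivAt
      exact ((hasFDerivAt_comp_add_right _).2 h).const_mul (c θ)
  refine (hder.differentiableAt.const_smul ((2 * Real.pi * Complex.I : ℂ)⁻¹)).congr_of_eventuallyEq
    ?_
  filter_upwards [ball_mem_nhds x₀ hρ] with x hx
  exact hrep x hx

/-- Holomorphic functions of several variables are smooth. -/
theorem contDiffOn_nat_of_differentiableOn_complex
    {E : Type*} [NormedAddCommGroup E] [NormedSpace ℂ E]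
    [FiniteDimensional ℂ E] {U : Set E} (hU : IsOpen U) (d : ℕ) {f : E → ℂ}
    (hf : DifferentiableOn ℂ f U) : ContDiffOn ℂ d f U := by
  induction d generalizing f with
  | zero => exact contDiffOn_zero.2 hf.continuousOn
  | succ d ih =>
    push_cast
    refine (contDiffOn_succ_iff_fderiv_of_isOpen hU).2 ⟨hf, by simp, ?_⟩
    exact contDiffOn_clm_apply.2 fun v => ih (differentiableOn_fderiv_apply hU hf v)

/-- Cauchy estimates for all iterated real derivatives of a holomorphic function. -/
theorem exists_norm_iteratedFDeriv_le.{u} {E : Type u} [NormedAddCommGroup E]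
    [NormedSpace ℂ E] (d : ℕ) {R : ℝ} (hR : 0 < R) :
    ∃ C : ℝ, ∃ r > 0, ∀ (G : Type u) [NormedAddCommGroup G] [NormedSpace ℂ G] (f : E → G) (c : E)
      (M : ℝ), ContDiffOn ℂ d f (ball c R) → (∀ x ∈ ball c R, ‖f x‖ ≤ M) →
      ∀ x ∈ ball c r, ‖iteratedFDeriv ℝ d f x‖ ≤ C * M := by
  induction d generalizing R with
  | zero =>
    refine ⟨1, R, hR, fun G _ _ f c M _ hM x hx => ?_⟩
    rw [norm_iteratedFDeriv_zero, one_mul]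
    exact hM x hx
  | succ d ih =>
    obtain ⟨C, r, hr, h⟩ := ih (half_pos hR)
    refine ⟨C * (2 / (R / 2)), min r (R / 2), lt_min hr (half_pos hR),
      fun G _ _ f c M hf hM x hx => ?_⟩
    have hsub : ball c (R / 2) ⊆ ball c R := ball_subset_ball (by linarith)
    have hxR : x ∈ ball c (R / 2) := ball_subset_ball (min_le_right _ _) hx
    push_cast at hf
    obtain ⟨hf1, -, hf2⟩ := (contDiffOn_succ_iff_fderiv_of_isOpen isOpen_ball).1 hf
    have hbd : ∀ y ∈ ball c (R / 2), ‖fderiv ℂ f y‖ ≤ 2 * M / (R / 2) := by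
      intro y hy
      have hyR : ball y (R / 2) ⊆ ball c R := by
        refine ball_subset_ball' ?_
        rw [mem_ball] at hy
        linarith
      exact norm_fderiv_le_of_norm_le_ball (half_pos hR) (hf1.mono hyR) fun z hz => hM z (hyR hz)
    have h1 := h _ (fderiv ℂ f) c _ (hf2.mono hsub) hbd x (ball_subset_ball (min_le_left _ _) hx)
    let T := ContinuousLinearMap.restrictScalarsIsometry ℂ E G ℝ ℝ
    have heq : fderiv ℝ f =ᶠ[𝓝 x] T ∘ fderiv ℂ f := by
      filter_upwards [isOpen_ball.mem_nhds (hsub hxR)] with y hy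
      exact (hf1.differentiableAt (isOpen_ball.mem_nhds hy)).fderiv_restrictScalars ℝ
    have hcd : ContDiffAt ℝ d (fderiv ℂ f) x :=
      (hf2.contDiffAt (isOpen_ball.mem_nhds (hsub hxR))).restrict_scalars ℝ
    rw [← norm_iteratedFDeriv_fderiv, (heq.iteratedFDeriv ℝ d).eq_of_nhds,
      T.norm_iteratedFDeriv_comp_left hcd le_rfl]
    refine h1.trans_eq ?_
    ring

theorem tendstoLocallyUniformlyOn_of_lipschitz {ι X Y : Type*} [PseudoMetricSpace X]
    [PseudoMetricSpace Y] {F : ι → X → Y} {g : X → Y} {l : Filter ι} {U : Set X}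
    (hF : ∀ x ∈ U, ∃ L : ℝ, ∃ t ∈ 𝓝 x, t ⊆ U ∧ ∀ᶠ j in l, ∀ y ∈ t,
      dist (F j y) (F j x) ≤ L * dist y x)
    (hg : ∀ x ∈ U, Tendsto (fun j => F j x) l (𝓝 (g x))) :
    TendstoLocallyUniformlyOn F g l U := by
  rcases l.eq_or_neBot with rfl | hl
  · exact fun _ _ _ _ => ⟨U, self_mem_nhdsWithin, by simp⟩
  rw [Metric.tendstoLocallyUniformlyOn_iff]
  intro ε hε x hx
  obtain ⟨L, t, ht, htU, hL⟩ := hF x hx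
  have hgL : ∀ y ∈ t, dist (g y) (g x) ≤ L * dist y x := fun y hy =>
    le_of_tendsto ((hg y (htU hy)).dist (hg x hx)) (hL.mono fun j hj => hj y hy)
  have hsmall : ∀ᶠ y in 𝓝 x, L * dist y x < ε / 3 := by
    have : Tendsto (fun y => L * dist y x) (𝓝 x) (𝓝 0) := by
      have : Continuous fun y => L * dist y x := by fun_prop
      simpa using this.tendsto x
    exact this.eventually_lt_const (by linarith)
  refine ⟨t ∩ {y | L * dist y x < ε / 3}, mem_nhdsWithin_of_mem_nhds (inter_mem ht hsmall), ?_⟩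
  filter_upwards [hL, (Metric.tendsto_nhds.1 (hg x hx)) (ε / 3) (by linarith)] with j hj hjx y hy
  have h1 := hgL y hy.1
  have h2 := hj y hy.1
  have h3 : L * dist y x < ε / 3 := hy.2
  rw [dist_comm] at hjx
  rw [dist_comm] at h2
  linarith [dist_triangle4 (g y) (g x) (F j x) (F j y)]

/-- Eventually, the functions `F j` are holomorphic and uniformly bounded near each point of `U`. -/
def EventuallyLocallyBoundedHol {ι E G : Type*} [NormedAddCommGroup E] [NormedSpace ℂ E]
    [NormedAddCommGroup G] [NormedSpace ℂ G] (F : ι → E → G) (l : Filter ι) (U : Set E) : Prop :=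
  ∀ x ∈ U, ∃ M : ℝ, ∃ R > 0, ball x R ⊆ U ∧ ∀ᶠ j in l, DifferentiableOn ℂ (F j) (ball x R) ∧
    ∀ y ∈ ball x R, ‖F j y‖ ≤ M

section
variable {ι E G : Type*} [NormedAddCommGroup E] [NormedSpace ℂ E]
    [NormedAddCommGroup G] [NormedSpace ℂ G] {F : ι → E → G} {U : Set E}

/-- **Vitali's theorem**, in the weak form where pointwise convergence holds everywhere. -/
theorem EventuallyLocallyBoundedHol.tendstoLocallyUniformlyOn {l : Filter ι} {g : E → G}
    (hF : EventuallyLocallyBoundedHol F l U)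
    (hg : ∀ x ∈ U, Tendsto (fun j => F j x) l (𝓝 (g x))) :
    TendstoLocallyUniformlyOn F g l U := by
  refine tendstoLocallyUniformlyOn_of_lipschitz (fun x hx => ?_) hg
  obtain ⟨M, R, hR, hRU, h⟩ := hF x hx
  refine ⟨4 * M / R, ball x (R / 4), ball_mem_nhds _ (by linarith),
    (ball_subset_ball (by linarith)).trans hRU, ?_⟩
  filter_upwards [h] with j hj y hy
  exact dist_le_of_norm_le_ball hR hj.1 hj.2 hy (mem_ball_self (by linarith))

/-- **Montel's theorem**, in terms of ultrafilters. -/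
theorem EventuallyLocallyBoundedHol.exists_tendsto [ProperSpace G] {l : Ultrafilter ι}
    (hF : EventuallyLocallyBoundedHol F l U) :
    ∃ g : E → G, TendstoLocallyUniformlyOn F g l U := by
  have : ∀ x, ∃ y, x ∈ U → Tendsto (fun j => F j x) l (𝓝 y) := by
    intro x
    by_cases hx : x ∈ U
    · obtain ⟨M, R, hR, -, h⟩ := hF x hx
      have hmem : closedBall (0 : G) M ∈ (l.map fun j => F j x) := by
        refine h.mono fun j hj => ?_
        simpa using hj.2 x (mem_ball_self hR)
      obtain ⟨y, -, hy⟩ := (isCompact_closedBall (0 : G) M).ultrafilter_le_nhds' _ hmem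
      exact ⟨y, fun _ => hy⟩
    · exact ⟨0, fun h => absurd h hx⟩
  choose g hg using this
  exact ⟨g, hF.tendstoLocallyUniformlyOn fun x hx => hg x hx⟩

theorem EventuallyLocallyBoundedHol.differentiableOn [FiniteDimensional ℂ E] {F : ι → E → ℂ}
    {l : Ultrafilter ι} {g : E → ℂ} (hF : EventuallyLocallyBoundedHol F l U)
    (hg : TendstoLocallyUniformlyOn F g l U) : DifferentiableOn ℂ g U := by
  have hF' : EventuallyLocallyBoundedHol (fun j => fderiv ℂ (F j)) l U := by
    intro x hx
    obtain ⟨M, R, hR, hRU, h⟩ := hF x hx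
    have hsub : ball x (R / 2) ⊆ ball x R := ball_subset_ball (by linarith)
    refine ⟨2 * M / (R / 2), R / 2, half_pos hR, hsub.trans hRU, ?_⟩
    filter_upwards [h] with j hj
    have hcd := contDiffOn_nat_of_differentiableOn_complex isOpen_ball 2 hj.1
    refine ⟨((hcd.fderiv_of_isOpen (m := 1) isOpen_ball (by norm_num)).differentiableOn
      one_ne_zero).mono hsub, fun y hy => ?_⟩
    have hyR : ball y (R / 2) ⊆ ball x R := by
      refine ball_subset_ball' ?_
      rw [mem_ball] at hy
      linarith
    exact norm_fderiv_le_of_norm_le_ball (half_pos hR) (hj.1.mono hyR) fun z hz => hj.2 z (hyR hz)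
  have : ProperSpace (E →L[ℂ] ℂ) := FiniteDimensional.proper ℂ _
  obtain ⟨g', hg'⟩ := hF'.exists_tendsto
  intro x hx
  obtain ⟨M, R, hR, hRU, h⟩ := hF x hx
  have hmem : ball x R ∈ 𝓝 x := ball_mem_nhds x hR
  have hev : ∀ᶠ n : ι × E in (l : Filter ι) ×ˢ 𝓝 x,
      HasFDerivAt (F n.1) (fderiv ℂ (F n.1) n.2) n.2 := by
    filter_upwards [prod_mem_prod h hmem] with n hn
    exact (hn.1.1.differentiableAt (isOpen_ball.mem_nhds hn.2)).hasFDerivAt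
  have hunif : TendstoUniformlyOnFilter (fun j => fderiv ℂ (F j)) g' l (𝓝 x) := by
    have := (tendstoLocallyUniformlyOn_iff_filter.1 (hg'.mono hRU)) x (mem_ball_self hR)
    rwa [nhdsWithin_eq_nhds.2 hmem] at this
  refine (hasFDerivAt_of_tendstoUniformlyOnFilter hunif hev ?_).differentiableAt
    |>.differentiableWithinAt
  filter_upwards [hmem] with y hy
  exact hg.tendsto_at (hRU hy)

end

theorem volume_preserving_circle_smul {n : ℕ} (a : Circle) :
    MeasurePreserving (fun z : Fin n → ℂ => (a : ℂ) • z) volume volume :=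
  volume_preserving_pi fun _ => (rotation a).measurePreserving

theorem enorm_le_lintegral_circle {n : ℕ} {Ω : Set (Fin n → ℂ)} {f : (Fin n → ℂ) → ℂ}
    (hf : DifferentiableOn ℂ f Ω) {w z : Fin n → ℂ} {r : ℝ} (hw : closedBall w r ⊆ Ω)
    (hz : z ∈ closedBall 0 r) :
    ENNReal.ofReal (2 * Real.pi) * ‖f w‖ₑ ≤
      ∫⁻ θ in Ioc 0 (2 * Real.pi), ‖f (w + (Circle.exp θ : ℂ) • z)‖ₑ := by
  have hmaps : MapsTo (fun ζ : ℂ => w + ζ • z) (closedBall 0 1) Ω := by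
    intro ζ hζ
    apply hw
    rw [mem_closedBall, dist_zero_right] at hζ hz
    rw [mem_closedBall, dist_eq_norm, add_sub_cancel_left, norm_smul]
    nlinarith [norm_nonneg z]
  have hd : DiffContOnCl ℂ (fun ζ : ℂ => f (w + ζ • z)) (ball 0 |1|) := by
    rw [abs_one]
    exact (hf.comp (by fun_prop) hmaps).diffContOnCl_ball subset_rfl
  have h := hd.circleAverage
  rw [Real.circleAverage_def, intervalIntegral.integral_of_le (by positivity)] at h
  simp only [zero_smul, add_zero] at h
  have h2 : (2 * Real.pi) • f w =
      ∫ θ in Ioc 0 (2 * Real.pi), f (w + circleMap 0 1 θ • z) := by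
    rw [← h, smul_inv_smul₀ (by positivity)]
  have h3 : ENNReal.ofReal (2 * Real.pi) * ‖f w‖ₑ = ‖(2 * Real.pi) • f w‖ₑ := by
    rw [enorm_smul, Real.enorm_of_nonneg (by positivity)]
  rw [h3, h2]
  refine (enorm_integral_le_lintegral_enorm _).trans_eq ?_
  simp [circleMap_zero, Circle.coe_exp]

theorem volume_mul_enorm_le {n : ℕ} {Ω : Set (Fin n → ℂ)} {f : (Fin n → ℂ) → ℂ}
    (hf : DifferentiableOn ℂ f Ω) {w : Fin n → ℂ} {r : ℝ} (hw : closedBall w r ⊆ Ω) :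
    volume (closedBall (0 : Fin n → ℂ) r) * ‖f w‖ₑ ≤ ∫⁻ z in Ω, ‖f z‖ₑ := by
  set B := closedBall (0 : Fin n → ℂ) r with hB
  set g : (Fin n → ℂ) → ℝ≥0∞ := (closedBall w r).indicator fun z => ‖f z‖ₑ with hg
  have hgm : Measurable g := by
    classical
    rw [hg, ← piecewise_eq_indicator]
    exact ((hf.continuousOn.mono hw).enorm).measurable_piecewise continuousOn_const
      measurableSet_closedBall
  have hmem : ∀ (θ : ℝ), ∀ z ∈ B, w + (Circle.exp θ : ℂ) • z ∈ closedBall w r := by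
    intro θ z hz
    rw [hB, mem_closedBall, dist_zero_right] at hz
    rw [mem_closedBall, dist_eq_norm, add_sub_cancel_left, norm_smul, Circle.norm_coe, one_mul]
    exact hz
  have h1 : ∀ z ∈ B, ENNReal.ofReal (2 * Real.pi) * ‖f w‖ₑ ≤
      ∫⁻ θ in Ioc 0 (2 * Real.pi), g (w + (Circle.exp θ : ℂ) • z) := by
    intro z hz
    refine (enorm_le_lintegral_circle hf hw hz).trans_eq (lintegral_congr fun θ => ?_)
    rw [hg, indicator_of_mem (hmem θ z hz)]
  have h2 : ∀ θ : ℝ, ∫⁻ z in B, g (w + (Circle.exp θ : ℂ) • z) ≤ ∫⁻ z in Ω, ‖f z‖ₑ := by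
    intro θ
    calc ∫⁻ z in B, g (w + (Circle.exp θ : ℂ) • z)
        ≤ ∫⁻ z, g (w + (Circle.exp θ : ℂ) • z) := setLIntegral_le_lintegral _ _
      _ = ∫⁻ z, g (w + z) :=
          (volume_preserving_circle_smul (Circle.exp θ)).lintegral_comp
            (f := fun z => g (w + z)) (hgm.comp (measurable_const_add w))
      _ = ∫⁻ z, g z := lintegral_add_left_eq_self g w
      _ = ∫⁻ z in closedBall w r, ‖f z‖ₑ := lintegral_indicator measurableSet_closedBall _
      _ ≤ _ := lintegral_mono_set hw
  have h3 : ENNReal.ofReal (2 * Real.pi) * (volume B * ‖f w‖ₑ) ≤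
      ENNReal.ofReal (2 * Real.pi) * ∫⁻ z in Ω, ‖f z‖ₑ := by
    calc ENNReal.ofReal (2 * Real.pi) * (volume B * ‖f w‖ₑ)
        = ∫⁻ _ in B, ENNReal.ofReal (2 * Real.pi) * ‖f w‖ₑ := by
          rw [setLIntegral_const]; ring
      _ ≤ ∫⁻ z in B, ∫⁻ θ in Ioc 0 (2 * Real.pi), g (w + (Circle.exp θ : ℂ) • z) :=
          setLIntegral_mono' measurableSet_closedBall h1
      _ = ∫⁻ θ in Ioc 0 (2 * Real.pi), ∫⁻ z in B, g (w + (Circle.exp θ : ℂ) • z) := by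
          refine lintegral_lintegral_swap (hgm.comp ?_).aemeasurable
          exact (by fun_prop : Continuous fun p : (Fin n → ℂ) × ℝ =>
            w + (Circle.exp p.2 : ℂ) • p.1).measurable
      _ ≤ ∫⁻ θ in Ioc 0 (2 * Real.pi), ∫⁻ z in Ω, ‖f z‖ₑ := lintegral_mono h2
      _ = ENNReal.ofReal (2 * Real.pi) * ∫⁻ z in Ω, ‖f z‖ₑ := by
          rw [setLIntegral_const, Real.volume_Ioc, sub_zero, mul_comm]
  exact (ENNReal.mul_le_mul_iff_right (by simp [Real.pi_pos]) ENNReal.ofReal_ne_top).1 h3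

theorem volume_mul_norm_sq_le {n : ℕ} {Ω : Set (Fin n → ℂ)} {f : (Fin n → ℂ) → ℂ}
    (hf : DifferentiableOn ℂ f Ω) (hf2 : MemLp f 2 (volume.restrict Ω))
    {w : Fin n → ℂ} {r : ℝ} (hw : closedBall w r ⊆ Ω) :
    volume.real (closedBall (0 : Fin n → ℂ) r) * ‖f w‖ ^ 2 ≤ ∫ z in Ω, ‖f z‖ ^ 2 := by
  have h := volume_mul_enorm_le (hf.pow 2) hw
  have hint : Integrable (fun z => ‖f z‖ ^ 2) (volume.restrict Ω) :=
    hf2.integrable_norm_pow (by simp)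
  have h0 : 0 ≤ ∫ z in Ω, ‖f z‖ ^ 2 := integral_nonneg fun _ => by positivity
  have hr : ∫⁻ z in Ω, ‖f z ^ 2‖ₑ = ENNReal.ofReal (∫ z in Ω, ‖f z‖ ^ 2) := by
    rw [ofReal_integral_eq_lintegral_ofReal hint (Eventually.of_forall fun _ => by positivity)]
    refine lintegral_congr fun z => ?_
    rw [← norm_pow, ofReal_norm]
  have h1 : ENNReal.ofReal (volume.real (closedBall (0 : Fin n → ℂ) r) * ‖f w‖ ^ 2) ≤
      ENNReal.ofReal (∫ z in Ω, ‖f z‖ ^ 2) := by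
    rw [← hr, ENNReal.ofReal_mul (by positivity), measureReal_def,
      ENNReal.ofReal_toReal (isCompact_closedBall _ _).measure_ne_top, ← norm_pow,
      ofReal_norm]
    exact h
  exact (ENNReal.ofReal_le_ofReal_iff h0).1 h1

section BergmanKernel

variable {n : ℕ} {Ω : Set (Fin n → ℂ)} {K : (Fin n → ℂ) → (Fin n → ℂ) → ℂ}

theorem IsBergmanKernel.diag_eq (hK : IsBergmanKernel Ω K) {w : Fin n → ℂ} (hw : w ∈ Ω) :
    K w w = ((∫ z in Ω, ‖K z w‖ ^ 2 : ℝ) : ℂ) := by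
  rw [hK.2 _ (hK.1 w hw) w hw, ← integral_complex_ofReal]
  congr 1 with z
  rw [Complex.mul_conj']
  push_cast
  rfl

theorem IsBergmanKernel.integral_norm_sq (hK : IsBergmanKernel Ω K) {w : Fin n → ℂ} (hw : w ∈ Ω) :
    ∫ z in Ω, ‖K z w‖ ^ 2 = ‖K w w‖ := by
  rw [hK.diag_eq hw, Complex.norm_real, Real.norm_of_nonneg]
  exact integral_nonneg fun _ => by positivity

theorem IsBergmanKernel.diag_eq_norm (hK : IsBergmanKernel Ω K) {w : Fin n → ℂ} (hw : w ∈ Ω) :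
    K w w = (‖K w w‖ : ℂ) := by
  rw [← hK.integral_norm_sq hw, ← hK.diag_eq hw]

theorem IsBergmanKernel.conj_eq (hK : IsBergmanKernel Ω K) {z w : Fin n → ℂ} (hz : z ∈ Ω)
    (hw : w ∈ Ω) : starRingEnd ℂ (K w z) = K z w := by
  rw [hK.2 _ (hK.1 z hz) w hw, hK.2 _ (hK.1 w hw) z hz, ← integral_conj]
  simp [mul_comm]

theorem IsBergmanKernel.volume_mul_norm_sq_le (hK : IsBergmanKernel Ω K) {z w : Fin n → ℂ}
    (hw : w ∈ Ω) {r : ℝ} (hz : closedBall z r ⊆ Ω) :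
    volume.real (closedBall (0 : Fin n → ℂ) r) * ‖K z w‖ ^ 2 ≤ ‖K w w‖ := by
  rw [← hK.integral_norm_sq hw]
  exact _root_.volume_mul_norm_sq_le (hK.1 w hw).1 (hK.1 w hw).2 hz

theorem IsBergmanKernel.norm_le (hK : IsBergmanKernel Ω K) {z w : Fin n → ℂ} {r : ℝ} (hr : 0 < r)
    (hz : closedBall z r ⊆ Ω) (hw : closedBall w r ⊆ Ω) :
    ‖K z w‖ ≤ (volume.real (closedBall (0 : Fin n → ℂ) r))⁻¹ := by
  have hwΩ : w ∈ Ω := hw (mem_closedBall_self hr.le)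
  set V := volume.real (closedBall (0 : Fin n → ℂ) r)
  have hV : 0 < V :=
    ENNReal.toReal_pos (measure_closedBall_pos _ _ hr).ne' (isCompact_closedBall _ _).measure_ne_top
  have h1 : V * ‖K w w‖ ^ 2 ≤ ‖K w w‖ := hK.volume_mul_norm_sq_le hwΩ hw
  have h2 : V * ‖K w w‖ ≤ 1 := by
    rcases (norm_nonneg (K w w)).eq_or_lt with h0 | h0
    · rw [← h0]; simp
    · refine le_of_mul_le_mul_right ?_ h0
      linarith
  have h3 : V * ‖K z w‖ ^ 2 ≤ ‖K w w‖ := hK.volume_mul_norm_sq_le hwΩ hz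
  rw [← one_div, le_div_iff₀' hV]
  refine abs_le_of_sq_le_sq' ?_ zero_le_one |>.2
  nlinarith

theorem IsBergmanKernel.eq_of_integral_le (hΩ : IsOpen Ω) (hK : IsBergmanKernel Ω K)
    {g : (Fin n → ℂ) → ℂ} (hg : MemA2 Ω g) {z w : Fin n → ℂ} (hw : w ∈ Ω) (hgw : g w = K w w)
    (hle : ∫ x in Ω, ‖g x‖ ^ 2 ≤ ‖K w w‖) (hz : z ∈ Ω) : g z = K z w := by
  have hKw := hK.1 w hw
  have i1 : Integrable (fun x => ‖g x‖ ^ 2) (volume.restrict Ω) :=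
    hg.2.integrable_norm_pow (by simp)
  have i2 : Integrable (fun x => ‖K x w‖ ^ 2) (volume.restrict Ω) :=
    hKw.2.integrable_norm_pow (by simp)
  have i3 : Integrable (fun x => g x * starRingEnd ℂ (K x w)) (volume.restrict Ω) :=
    hg.2.integrable_mul hKw.2.star
  have hre : ∫ x in Ω, (g x * starRingEnd ℂ (K x w)).re = ‖K w w‖ := by
    have := integral_re i3
    simp only [RCLike.re_to_complex] at this
    rw [this, ← hK.2 g hg w hw, hgw, hK.diag_eq_norm hw]
    simp
  have hsub : ∫ x in Ω, ‖g x - K x w‖ ^ 2 ≤ 0 := by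
    have : ∀ x, ‖g x - K x w‖ ^ 2 =
        ‖g x‖ ^ 2 + ‖K x w‖ ^ 2 - 2 * (g x * starRingEnd ℂ (K x w)).re := fun x => by
      simp only [← Complex.normSq_eq_norm_sq]
      exact Complex.normSq_sub _ _
    simp_rw [this]
    have i4 : Integrable (fun x => 2 * (g x * starRingEnd ℂ (K x w)).re) (volume.restrict Ω) :=
      i3.re.const_mul 2
    rw [integral_sub (i1.fun_add i2) i4, integral_add i1 i2, integral_const_mul, hre,
      hK.integral_norm_sq hw]
    linarith
  obtain ⟨r, hr, hrΩ⟩ := nhds_basis_closedBall.mem_iff.1 (hΩ.mem_nhds hz)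
  have h := _root_.volume_mul_norm_sq_le (hg.1.sub hKw.1) (hg.2.sub hKw.2) hrΩ
  have hV : 0 < volume.real (closedBall (0 : Fin n → ℂ) r) :=
    ENNReal.toReal_pos (measure_closedBall_pos _ _ hr).ne' (isCompact_closedBall _ _).measure_ne_top
  simp only [Pi.sub_apply] at h
  have h0 : ‖g z - K z w‖ ^ 2 ≤ 0 := by
    by_contra! hpos
    linarith [mul_pos hV hpos]
  have : ‖g z - K z w‖ = 0 := by
    have := sq_nonneg ‖g z - K z w‖
    exact pow_eq_zero_iff two_ne_zero |>.1 (le_antisymm h0 this)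
  exact sub_eq_zero.1 (norm_eq_zero.1 this)

/-- The kernel with its second argument conjugated. -/
def conjKernel (K : (Fin n → ℂ) → (Fin n → ℂ) → ℂ) (q : (Fin n → ℂ) × (Fin n → ℂ)) : ℂ :=
  K q.1 (star q.2)

theorem star_mem_ball {a b : Fin n → ℂ} {R : ℝ} (h : a ∈ ball b R) :
    star a ∈ ball (star b) R := by
  rwa [mem_ball, dist_star_star]

theorem IsBergmanKernel.norm_conjKernel_le (hK : IsBergmanKernel Ω K)
    {p q : (Fin n → ℂ) × (Fin n → ℂ)} {R : ℝ} (hR : 0 < R) (h1 : closedBall p.1 (2 * R) ⊆ Ω)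
    (h2 : closedBall (star p.2) (2 * R) ⊆ Ω) (hq : q ∈ ball p R) :
    ‖conjKernel K q‖ ≤ (volume.real (closedBall (0 : Fin n → ℂ) R))⁻¹ := by
  rw [mem_ball, Prod.dist_eq, max_lt_iff] at hq
  refine hK.norm_le hR ((closedBall_subset_closedBall' ?_).trans h1)
    ((closedBall_subset_closedBall' ?_).trans h2)
  · linarith
  · rw [dist_star_star]
    linarith

theorem IsBergmanKernel.differentiableAt_conjKernel (hΩ : IsOpen Ω) (hK : IsBergmanKernel Ω K)
    {p : (Fin n → ℂ) × (Fin n → ℂ)} (h1 : p.1 ∈ Ω) (h2 : star p.2 ∈ Ω) :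
    DifferentiableAt ℂ (conjKernel K) p := by
  obtain ⟨r, hr, hrΩ⟩ := nhds_basis_closedBall.mem_iff.1 (hΩ.mem_nhds h1)
  obtain ⟨s, hs, hsΩ⟩ := nhds_basis_closedBall.mem_iff.1 (hΩ.mem_nhds h2)
  set R := min r s / 2 with hRdef
  have hR : 0 < R := half_pos (lt_min hr hs)
  have hRr : 2 * R ≤ r := by linarith [min_le_left r s]
  have hRs : 2 * R ≤ s := by linarith [min_le_right r s]
  have hball1 : ball p.1 R ⊆ Ω :=
    (ball_subset_closedBall.trans (closedBall_subset_closedBall (by linarith))).trans hrΩ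
  have hball2 : ball (star p.2) R ⊆ Ω :=
    (ball_subset_closedBall.trans (closedBall_subset_closedBall (by linarith))).trans hsΩ
  refine differentiableAt_of_separately (f := fun z w => K z (star w))
    (M := (volume.real (closedBall (0 : Fin n → ℂ) R))⁻¹) hR (fun y hy => ?_)
    (fun x hx => ?_) (fun x hx y hy => ?_)
  · exact (hK.1 _ (hball2 (star_mem_ball hy))).1.mono hball1
  · intro y hy
    have hxΩ := hball1 hx
    have hyΩ := hball2 (star_mem_ball hy)
    have hd : DifferentiableAt ℂ (fun u => star (K (star u) x)) y := by
      simpa [Function.comp_def] using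
        ((hK.1 x hxΩ).1.differentiableAt (hΩ.mem_nhds hyΩ)).star_star
    refine (hd.congr_of_eventuallyEq ?_).differentiableWithinAt
    filter_upwards [isOpen_ball.mem_nhds hy] with u hu
    exact (hK.conj_eq hxΩ (hball2 (star_mem_ball hu))).symm
  · refine hK.norm_conjKernel_le (p := p) (q := (x, y)) hR
      ((closedBall_subset_closedBall hRr).trans hrΩ)
      ((closedBall_subset_closedBall hRs).trans hsΩ) ?_
    rw [← ball_prod_same]
    exact ⟨hx, hy⟩

end BergmanKernel

section Convergence

theorem MeasureTheory.MemLp.eLpNorm_two_eq_sqrt {α : Type*} [MeasurableSpace α] {μ : Measure α}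
    {f : α → ℂ} (hf : MemLp f 2 μ) : eLpNorm f 2 μ = ENNReal.ofReal √(∫ x, ‖f x‖ ^ 2 ∂μ) := by
  rw [hf.eLpNorm_eq_integral_rpow_norm two_ne_zero ENNReal.ofNat_ne_top, Real.sqrt_eq_rpow]
  simp

theorem eLpNorm_two_le_of_forall_isCompact {n : ℕ} {U : Set (Fin n → ℂ)} (hU : IsOpen U)
    {g : (Fin n → ℂ) → ℂ} {C : ℝ≥0∞}
    (h : ∀ D, IsCompact D → D ⊆ U → eLpNorm g 2 (volume.restrict D) ≤ C) :
    eLpNorm g 2 (volume.restrict U) ≤ C := by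
  have hsq : ∀ μ : Measure (Fin n → ℂ), eLpNorm g 2 μ ^ (2 : ℝ) = ∫⁻ x, ‖g x‖ₑ ^ (2 : ℝ) ∂μ :=
    fun μ => eLpNorm_nnreal_pow_eq_lintegral (p := 2) two_ne_zero
  obtain ⟨F, hFc, hFU, hF, hmono⟩ := hU.exists_iUnion_isClosed
  let D : ℕ → Set (Fin n → ℂ) := fun k => F k ∩ closedBall 0 k
  have hDmono : Monotone D := fun a b hab =>
    inter_subset_inter (hmono hab) (closedBall_subset_closedBall (by exact_mod_cast hab))
  have hDU : ⋃ k, D k = U := by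
    refine (iUnion_subset fun k => inter_subset_left.trans (hFU k)).antisymm fun x hx => ?_
    rw [← hF, mem_iUnion] at hx
    obtain ⟨k, hk⟩ := hx
    obtain ⟨m, hm⟩ := exists_nat_ge ‖x‖
    refine mem_iUnion.2 ⟨max k m, hmono (le_max_left _ _) hk, ?_⟩
    rw [mem_closedBall, dist_zero_right]
    exact hm.trans (by exact_mod_cast le_max_right _ _)
  rw [← ENNReal.rpow_le_rpow_iff (z := 2) two_pos, hsq, ← hDU,
    setLIntegral_iUnion_of_directed _ hDmono.directed_le]
  refine iSup_le fun k => ?_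
  rw [← hsq, ENNReal.rpow_le_rpow_iff two_pos]
  exact h _ ((isCompact_closedBall _ _).inter_left (hFc k)) (inter_subset_left.trans (hFU k))

theorem IsBergmanKernel.eLpNorm_eq {n : ℕ} {Ω : Set (Fin n → ℂ)}
    {K : (Fin n → ℂ) → (Fin n → ℂ) → ℂ} (hK : IsBergmanKernel Ω K) {w : Fin n → ℂ} (hw : w ∈ Ω) :
    eLpNorm (fun z => K z w) 2 (volume.restrict Ω) = ENNReal.ofReal √‖K w w‖ := by
  rw [(hK.1 w hw).2.eLpNorm_two_eq_sqrt, hK.integral_norm_sq hw]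

/-- Weak lower semicontinuity of the `L²` norm under locally uniform convergence. -/
theorem eLpNorm_le_of_tendstoLocallyUniformlyOn {n : ℕ} {ι : Type*} {l : Filter ι} [l.NeBot]
    {U : Set (Fin n → ℂ)} (hU : IsOpen U) {F : ι → (Fin n → ℂ) → ℂ} {g : (Fin n → ℂ) → ℂ}
    {Ω : ι → Set (Fin n → ℂ)} {a : ι → ℝ≥0∞} {C : ℝ≥0∞}
    (hΩ : ∀ D, IsCompact D → D ⊆ U → ∀ᶠ j in l, D ⊆ Ω j)
    (hF : ∀ j, DifferentiableOn ℂ (F j) (Ω j)) (hg : ContinuousOn g U)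
    (ha : ∀ᶠ j in l, eLpNorm (F j) 2 (volume.restrict (Ω j)) ≤ a j) (hC : Tendsto a l (𝓝 C))
    (hlim : TendstoLocallyUniformlyOn F g l U) :
    eLpNorm g 2 (volume.restrict U) ≤ C := by
  refine eLpNorm_two_le_of_forall_isCompact hU fun D hD hDU => ?_
  have hunif := (tendstoLocallyUniformlyOn_iff_forall_isCompact hU).1 hlim D hDU hD
  set b : ℝ≥0∞ := volume D ^ (2 : ℝ)⁻¹ with hb
  have hb_top : b ≠ ⊤ := ENNReal.rpow_ne_top_of_nonneg (by positivity) hD.measure_ne_top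
  have key : ∀ ε > 0, eLpNorm g 2 (volume.restrict D) ≤ C + b * ENNReal.ofReal ε := by
    intro ε hε
    refine ge_of_tendsto (hC.add_const _) ?_
    filter_upwards [ha, hΩ D hD hDU, Metric.tendstoUniformlyOn_iff.1 hunif ε hε] with j hja hjD hj
    have hFm : AEStronglyMeasurable (F j) (volume.restrict D) :=
      ((hF j).continuousOn.mono hjD).aestronglyMeasurable hD.measurableSet
    have hgm : AEStronglyMeasurable g (volume.restrict D) :=
      (hg.mono hDU).aestronglyMeasurable hD.measurableSet
    calc eLpNorm g 2 (volume.restrict D)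
        = eLpNorm (F j + (g - F j)) 2 (volume.restrict D) := by rw [add_sub_cancel]
      _ ≤ eLpNorm (F j) 2 (volume.restrict D) + eLpNorm (g - F j) 2 (volume.restrict D) :=
          eLpNorm_add_le hFm (hgm.sub hFm) one_le_two
      _ ≤ a j + b * ENNReal.ofReal ε := by
          gcongr
          · exact (eLpNorm_mono_measure _ (Measure.restrict_mono_set _ hjD)).trans hja
          · refine (eLpNorm_le_of_ae_bound (C := ε) ?_).trans_eq (by simp [hb])
            filter_upwards [ae_restrict_mem hD.measurableSet] with x hx
            rw [Pi.sub_apply, ← dist_eq_norm]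
            exact (hj x hx).le
  have hlim0 : Tendsto (fun ε : ℝ => C + b * ENNReal.ofReal ε) (𝓝[>] 0) (𝓝 C) := by
    have h0 : Tendsto (fun ε : ℝ => ENNReal.ofReal ε) (𝓝[>] 0) (𝓝 0) := by
      simpa using (ENNReal.continuous_ofReal.tendsto 0).mono_left nhdsWithin_le_nhds
    simpa using (ENNReal.Tendsto.const_mul h0 (Or.inr hb_top)).const_add C
  exact ge_of_tendsto hlim0 (eventually_mem_nhdsWithin.mono key)

variable {n : ℕ} {Ω : ℕ → Set (Fin n → ℂ)} {Ωl : Set (Fin n → ℂ)}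
  {Kj : ℕ → (Fin n → ℂ) → (Fin n → ℂ) → ℂ} {Kl : (Fin n → ℂ) → (Fin n → ℂ) → ℂ}

theorem eventuallyLocallyBoundedHol_conjKernel (hopen : ∀ j, IsOpen (Ω j)) (hopenl : IsOpen Ωl)
    (hconv : LocalHausdorffConv Ω Ωl) (hKj : ∀ j, IsBergmanKernel (Ω j) (Kj j)) :
    EventuallyLocallyBoundedHol (fun j => conjKernel (Kj j)) atTop
      {q | q.1 ∈ Ωl ∧ star q.2 ∈ Ωl} := by
  rintro p ⟨h1, h2⟩
  obtain ⟨r, hr, hrΩ⟩ := nhds_basis_closedBall.mem_iff.1 (hopenl.mem_nhds h1)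
  obtain ⟨s, hs, hsΩ⟩ := nhds_basis_closedBall.mem_iff.1 (hopenl.mem_nhds h2)
  set R := min r s / 2 with hRdef
  have hR : 0 < R := half_pos (lt_min hr hs)
  have hRr : 2 * R ≤ r := by linarith [min_le_left r s]
  have hRs : 2 * R ≤ s := by linarith [min_le_right r s]
  have hsub1 := (closedBall_subset_closedBall hRr).trans hrΩ
  have hsub2 := (closedBall_subset_closedBall hRs).trans hsΩ
  have hin : ∀ S : Set (Fin n → ℂ), closedBall p.1 (2 * R) ⊆ S →
      closedBall (star p.2) (2 * R) ⊆ S → ∀ q ∈ ball p R, q.1 ∈ S ∧ star q.2 ∈ S := by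
    intro S hS1 hS2 q hq
    rw [← ball_prod_same] at hq
    refine ⟨hS1 ?_, hS2 ?_⟩
    · exact (ball_subset_ball (by linarith)).trans ball_subset_closedBall hq.1
    · exact (ball_subset_ball (by linarith)).trans ball_subset_closedBall (star_mem_ball hq.2)
  refine ⟨(volume.real (closedBall (0 : Fin n → ℂ) R))⁻¹, R, hR, hin Ωl hsub1 hsub2, ?_⟩
  filter_upwards [hconv.1 _ (isCompact_closedBall _ _) hsub1,
    hconv.1 _ (isCompact_closedBall _ _) hsub2] with j hj1 hj2
  refine ⟨fun q hq => ?_, fun q hq => (hKj j).norm_conjKernel_le hR hj1 hj2 hq⟩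
  obtain ⟨hq1, hq2⟩ := hin _ hj1 hj2 q hq
  exact ((hKj j).differentiableAt_conjKernel (hopen j) hq1 hq2).differentiableWithinAt

theorem EventuallyLocallyBoundedHol.kernel_left {l : Filter ℕ}
    (h : EventuallyLocallyBoundedHol (fun j => conjKernel (Kj j)) l
      {q | q.1 ∈ Ωl ∧ star q.2 ∈ Ωl}) {w : Fin n → ℂ} (hw : w ∈ Ωl) :
    EventuallyLocallyBoundedHol (fun j z => Kj j z w) l Ωl := by
  intro x hx
  obtain ⟨M, R, hR, hRU, hj⟩ := h (x, star w) ⟨hx, by simpa using hw⟩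
  have hmaps : MapsTo (fun z => (z, star w)) (ball x R) (ball (x, star w) R) := by
    intro z hz
    rw [← ball_prod_same]
    exact ⟨hz, mem_ball_self hR⟩
  refine ⟨M, R, hR, fun z hz => (hRU (hmaps hz)).1, ?_⟩
  filter_upwards [hj] with j hj
  have heq : (fun z => Kj j z w) = conjKernel (Kj j) ∘ fun z => (z, star w) := by
    ext z
    simp [conjKernel]
  refine ⟨heq ▸ hj.1.comp (by fun_prop) hmaps, fun y hy => ?_⟩
  simpa [conjKernel] using hj.2 _ (hmaps hy)

theorem tendsto_bergmanKernel (hopen : ∀ j, IsOpen (Ω j)) (hopenl : IsOpen Ωl)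
    (hconv : LocalHausdorffConv Ω Ωl) (hKj : ∀ j, IsBergmanKernel (Ω j) (Kj j))
    (hKl : IsBergmanKernel Ωl Kl)
    (hdiag : ∀ z ∈ Ωl, Tendsto (fun j => Kj j z z) atTop (𝓝 (Kl z z)))
    {z w : Fin n → ℂ} (hz : z ∈ Ωl) (hw : w ∈ Ωl) :
    Tendsto (fun j => Kj j z w) atTop (𝓝 (Kl z w)) := by
  rw [tendsto_iff_ultrafilter]
  intro 𝒰 h𝒰
  have hbdd : EventuallyLocallyBoundedHol (fun j z => Kj j z w) 𝒰 Ωl := by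
    refine EventuallyLocallyBoundedHol.kernel_left (fun x hx => ?_) hw
    obtain ⟨M, R, hR, hRU, h⟩ :=
      eventuallyLocallyBoundedHol_conjKernel hopen hopenl hconv hKj x hx
    exact ⟨M, R, hR, hRU, h𝒰 h⟩
  obtain ⟨g, hg⟩ := hbdd.exists_tendsto
  have hgd : DifferentiableOn ℂ g Ωl := hbdd.differentiableOn hg
  have hgw : g w = Kl w w := tendsto_nhds_unique (hg.tendsto_at hw) ((hdiag w hw).mono_left h𝒰)
  have hwΩ : ∀ᶠ j in (𝒰 : Filter ℕ), w ∈ Ω j := by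
    filter_upwards [h𝒰 (hconv.1 {w} isCompact_singleton (by simpa using hw))] with j hj
    exact hj rfl
  -- off the eventual set, replace the kernel section by zero
  have hnorm : eLpNorm g 2 (volume.restrict Ωl) ≤ ENNReal.ofReal √‖Kl w w‖ := by
    classical
    refine eLpNorm_le_of_tendstoLocallyUniformlyOn hopenl (l := 𝒰) (F := fun j z => Kj j z w)
      (Ω := fun j => if w ∈ Ω j then Ω j else ∅)
      (a := fun j => ENNReal.ofReal √‖Kj j w w‖) (fun D hD hDU => ?_) (fun j => ?_)
      hgd.continuousOn ?_ ?_ hg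
    · filter_upwards [hwΩ, h𝒰 (hconv.1 D hD hDU)] with j hj hjD
      rwa [if_pos hj]
    · split_ifs with hj
      · exact ((hKj j).1 w hj).1
      · exact differentiableOn_empty
    · filter_upwards [hwΩ] with j hj
      rw [if_pos hj, (hKj j).eLpNorm_eq hj]
    · exact ((ENNReal.continuous_ofReal.comp Real.continuous_sqrt).tendsto _).comp
        ((hdiag w hw).mono_left h𝒰).norm
  have hgm : MemA2 Ωl g := ⟨hgd, hgd.continuousOn.aestronglyMeasurable hopenl.measurableSet,
    hnorm.trans_lt ENNReal.ofReal_lt_top⟩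
  have hint : ∫ x in Ωl, ‖g x‖ ^ 2 ≤ ‖Kl w w‖ := by
    rw [hgm.2.eLpNorm_two_eq_sqrt, ENNReal.ofReal_le_ofReal_iff (Real.sqrt_nonneg _)] at hnorm
    exact (Real.sqrt_le_sqrt_iff (norm_nonneg _)).1 hnorm
  rw [← hKl.eq_of_integral_le hopenl hgm hw hgw hint hz]
  exact hg.tendsto_at hz

end Convergence

/-- **Weierstrass' theorem** on the convergence of derivatives, in several variables. -/
theorem EventuallyLocallyBoundedHol.tendstoLocallyUniformlyOn_iteratedFDeriv {ι : Type*}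
    {E : Type} [NormedAddCommGroup E] [NormedSpace ℂ E] [FiniteDimensional ℂ E] {F : ι → E → ℂ}
    {l : Filter ι} {U : Set E} {g : E → ℂ} (hF : EventuallyLocallyBoundedHol F l U)
    (hgd : DifferentiableOn ℂ g U) (hg : TendstoLocallyUniformlyOn F g l U) (d : ℕ) :
    TendstoLocallyUniformlyOn (fun j => iteratedFDeriv ℝ d (F j)) (iteratedFDeriv ℝ d g) l U := by
  have : ProperSpace E := FiniteDimensional.proper ℂ E
  rw [Metric.tendstoLocallyUniformlyOn_iff]
  intro ε hε x hx
  obtain ⟨M, R, hR, hRU, h⟩ := hF x hx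
  obtain ⟨C, r, hr, hC⟩ := exists_norm_iteratedFDeriv_le (E := E) d (half_pos hR)
  have hsub : ball x (R / 2) ⊆ ball x R := ball_subset_ball (by linarith)
  have hunif : TendstoUniformlyOn F g l (closedBall x (R / 2)) :=
    (tendstoLocallyUniformlyOn_iff_forall_isCompact isOpen_ball).1 (hg.mono hRU) _
      (closedBall_subset_ball (by linarith)) (isCompact_closedBall _ _)
  obtain ⟨δ, hδ, hCδ⟩ : ∃ δ > 0, C * δ < ε := by
    refine ⟨ε / (|C| + 1), by positivity, ?_⟩
    rw [← mul_div_assoc, div_lt_iff₀ (by positivity)]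
    nlinarith [le_abs_self C]
  refine ⟨ball x (min r (R / 2)),
    mem_nhdsWithin_of_mem_nhds (ball_mem_nhds x (lt_min hr (half_pos hR))), ?_⟩
  filter_upwards [h, Metric.tendstoUniformlyOn_iff.1 hunif δ hδ] with j hj hjδ y hy
  have hyR : ball x R ∈ 𝓝 y :=
    isOpen_ball.mem_nhds (hsub (ball_subset_ball (min_le_right _ _) hy))
  have hcg := contDiffOn_nat_of_differentiableOn_complex isOpen_ball d (hgd.mono hRU)
  have hcF := contDiffOn_nat_of_differentiableOn_complex isOpen_ball d hj.1
  rw [dist_eq_norm, ← iteratedFDeriv_sub_apply ((hcg.contDiffAt hyR).restrict_scalars ℝ)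
    ((hcF.contDiffAt hyR).restrict_scalars ℝ)]
  refine (hC ℂ (g - F j) x δ ((hcg.sub hcF).mono hsub) (fun z hz => ?_) y
    (ball_subset_ball (min_le_left _ _) hy)).trans_lt hCδ
  rw [Pi.sub_apply, ← dist_eq_norm]
  exact (hjδ z (ball_subset_closedBall hz)).le

theorem TendstoLocallyUniformlyOn.iteratedFDeriv_comp_linearIsometryEquiv {ι E G H : Type*}
    [NormedAddCommGroup E] [NormedSpace ℝ E] [NormedAddCommGroup G] [NormedSpace ℝ G]
    [NormedAddCommGroup H] [NormedSpace ℝ H] {F : ι → E → H} {g : E → H} {l : Filter ι}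
    {U : Set E} {d : ℕ}
    (h : TendstoLocallyUniformlyOn (fun j => iteratedFDeriv ℝ d (F j)) (iteratedFDeriv ℝ d g) l U)
    (T : G ≃ₗᵢ[ℝ] E) {V : Set G} (hT : MapsTo T V U) :
    TendstoLocallyUniformlyOn (fun j => iteratedFDeriv ℝ d (F j ∘ T)) (iteratedFDeriv ℝ d (g ∘ T))
      l V := by
  have hcomp : ∀ (f : E → H) (x : G), iteratedFDeriv ℝ d (f ∘ T) x =
      (iteratedFDeriv ℝ d f (T x)).compContinuousLinearMap fun _ => (T : G →L[ℝ] E) := by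
    intro f x
    simpa [iteratedFDerivWithin_univ] using
      T.toContinuousLinearEquiv.iteratedFDerivWithin_comp_right f uniqueDiffOn_univ
        (mem_univ (T x)) d
  have h' := h.comp T hT T.continuous.continuousOn
  rw [Metric.tendstoLocallyUniformlyOn_iff] at h' ⊢
  intro ε hε x hx
  obtain ⟨t, ht, hj⟩ := h' ε hε x hx
  refine ⟨t, ht, hj.mono fun j hj y hy => ?_⟩
  have hsub : ∀ A B : ContinuousMultilinearMap ℝ (fun _ : Fin d => E) H,
      A.compContinuousLinearMap (fun _ => (T : G →L[ℝ] E)) -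
        B.compContinuousLinearMap (fun _ => (T : G →L[ℝ] E)) =
      (A - B).compContinuousLinearMap fun _ => (T : G →L[ℝ] E) := fun A B => by
    ext
    simp
  rw [hcomp, hcomp, dist_eq_norm, hsub,
    ContinuousMultilinearMap.norm_compContinuous_linearIsometryEquiv _ fun _ => T, ← dist_eq_norm]
  exact hj y hy

/-- Conjugation in the second variable of `ℂⁿ × ℂⁿ`, as a real-linear isometry. -/
def conjSnd (n : ℕ) : ((Fin n → ℂ) × (Fin n → ℂ)) ≃ₗᵢ[ℝ] ((Fin n → ℂ) × (Fin n → ℂ)) where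
  toFun q := (q.1, star q.2)
  invFun q := (q.1, star q.2)
  map_add' p q := by simp
  map_smul' c q := by simp
  left_inv q := by simp
  right_inv q := by simp
  norm_map' q := by simp [Prod.norm_def]

@[simp]
theorem conjSnd_apply {n : ℕ} (q : (Fin n → ℂ) × (Fin n → ℂ)) :
    conjSnd n q = (q.1, star q.2) := rfl

theorem conjKernel_comp_conjSnd {n : ℕ} (K : (Fin n → ℂ) → (Fin n → ℂ) → ℂ) :
    conjKernel K ∘ conjSnd n = fun q => K q.1 q.2 := by
  ext q
  simp [conjKernel]

/-- stability of the Bergman kernels (with all derivatives) for a sequence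
of domains converging in the local Hausdorff sense. -/
theorem bergman_kernel_stability {n : ℕ} (Ω : ℕ → Set (Fin n → ℂ)) (Ωl : Set (Fin n → ℂ))
    (hopen : ∀ j, IsOpen (Ω j)) (hopenl : IsOpen Ωl)
    (hconv : LocalHausdorffConv Ω Ωl)
    (Kj : ℕ → (Fin n → ℂ) → (Fin n → ℂ) → ℂ) (hKj : ∀ j, IsBergmanKernel (Ω j) (Kj j))
    (Kl : (Fin n → ℂ) → (Fin n → ℂ) → ℂ) (hKl : IsBergmanKernel Ωl Kl)
    (hnz : ∀ z ∈ Ωl, Kl z z ≠ 0)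
    (hdiag : ∀ z ∈ Ωl, Filter.Tendsto (fun j => Kj j z z) Filter.atTop (nhds (Kl z z))) :
    TendstoLocallyUniformlyOn
      (fun j (zw : (Fin n → ℂ) × (Fin n → ℂ)) => Kj j zw.1 zw.2)
      (fun zw => Kl zw.1 zw.2) Filter.atTop (Ωl ×ˢ Ωl) ∧
    ∀ d : ℕ, TendstoLocallyUniformlyOn
      (fun j => iteratedFDeriv ℝ d (fun zw : (Fin n → ℂ) × (Fin n → ℂ) => Kj j zw.1 zw.2))
      (iteratedFDeriv ℝ d fun zw : (Fin n → ℂ) × (Fin n → ℂ) => Kl zw.1 zw.2)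
      Filter.atTop (Ωl ×ˢ Ωl) := by
  have hbdd := eventuallyLocallyBoundedHol_conjKernel hopen hopenl hconv hKj
  have hlim := hbdd.tendstoLocallyUniformlyOn (g := conjKernel Kl) fun q hq =>
    tendsto_bergmanKernel hopen hopenl hconv hKj hKl hdiag hq.1 hq.2
  have hd : DifferentiableOn ℂ (conjKernel Kl) {q | q.1 ∈ Ωl ∧ star q.2 ∈ Ωl} := fun q hq =>
    (hKl.differentiableAt_conjKernel hopenl hq.1 hq.2).differentiableWithinAt
  have hmaps : MapsTo (conjSnd n) (Ωl ×ˢ Ωl) {q | q.1 ∈ Ωl ∧ star q.2 ∈ Ωl} := fun q hq => by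
    simpa using hq
  refine ⟨?_, fun d => ?_⟩
  · simpa only [conjKernel_comp_conjSnd] using
      hlim.comp (conjSnd n) hmaps (conjSnd n).continuous.continuousOn
  · have hder := hbdd.tendstoLocallyUniformlyOn_iteratedFDeriv hd hlim d
    simpa only [conjKernel_comp_conjSnd] using
      hder.iteratedFDeriv_comp_linearIsometryEquiv (conjSnd n) hmaps

end
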